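/- Let n ≥ 1, let p₁, p₂ ≥ 2 and q₁, q₂, r₁, r₂ ≥ 0. Let (u, v) be a pair of nonnegative, twice continuously differentiable functions on ℝ^n satisfying -Δu = u^{q₁} v^{r₁} |∇u|^{p₁} and -Δv = v^{q₂} u^{r₂} |∇v|^{p₂} pointwise on ℝ^n, and suppose u, v, |∇u| and |∇v| are all bounded on ℝ^n. Then u and v are constant. -/

import Mathlib

/-- The Laplacian of `u : ℝⁿ → ℝ` at `x`, defined as the sum of the pure second
partial derivatives in the coordinate directions. -/
noncomputable def lap {n : ℕ} (u : EuclideanSpace ℝ (Fin n) → ℝ)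
    (x : EuclideanSpace ℝ (Fin n)) : ℝ :=
  ∑ i : Fin n,
    fderiv ℝ (fun y => fderiv ℝ u y (EuclideanSpace.single i (1 : ℝ))) x
      (EuclideanSpace.single i (1 : ℝ))

open MeasureTheory Filter Topology

/-- The positive part of `1 - ‖y‖²`, the weight of the averages used below. -/
noncomputable def paraboloid {n : ℕ} (y : EuclideanSpace ℝ (Fin n)) : ℝ :=
  max (1 - ‖y‖ ^ 2) 0

section Paraboloid

variable {n : ℕ}

theorem paraboloid_nonneg (y : EuclideanSpace ℝ (Fin n)) : 0 ≤ paraboloid y := le_max_right _ _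

theorem paraboloid_le_one (y : EuclideanSpace ℝ (Fin n)) : paraboloid y ≤ 1 :=
  max_le (by nlinarith [norm_nonneg y]) zero_le_one

theorem paraboloid_eq_zero {y : EuclideanSpace ℝ (Fin n)} (hy : 1 ≤ ‖y‖) : paraboloid y = 0 :=
  max_eq_right (by nlinarith)

theorem continuous_paraboloid : Continuous (paraboloid (n := n)) := by
  unfold paraboloid; fun_prop

theorem hasCompactSupport_paraboloid : HasCompactSupport (paraboloid (n := n)) :=
  HasCompactSupport.intro (isCompact_closedBall 0 1) fun y hy => paraboloid_eq_zero <| by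
    simp only [Metric.mem_closedBall, dist_zero_right, not_le] at hy
    exact hy.le

theorem integrable_paraboloid_mul {f : EuclideanSpace ℝ (Fin n) → ℝ} (hf : Continuous f) :
    Integrable fun y => paraboloid y * f y :=
  (continuous_paraboloid.mul hf).integrable_of_hasCompactSupport
    hasCompactSupport_paraboloid.mul_right

theorem integrable_paraboloid_sq_mul {f : EuclideanSpace ℝ (Fin n) → ℝ} (hf : Continuous f) :
    Integrable fun y => paraboloid y ^ 2 / 4 * f y := by
  refine (integrable_paraboloid_mul ((continuous_paraboloid.div_const 4).mul hf)).congr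
    (Eventually.of_forall fun y => ?_)
  simp only [Pi.mul_apply]
  ring

theorem integral_paraboloid_pos : 0 < ∫ y : EuclideanSpace ℝ (Fin n), paraboloid y :=
  continuous_paraboloid.integral_pos_of_hasCompactSupport_nonneg_nonzero
    hasCompactSupport_paraboloid paraboloid_nonneg (x := 0) (by simp [paraboloid])

end Paraboloid

theorem hasDerivAt_max_zero_sq (s : ℝ) :
    HasDerivAt (fun t : ℝ => max t 0 ^ 2) (2 * max s 0) s := by
  rw [hasDerivAt_iff_isLittleO]
  refine Asymptotics.IsBigO.trans_isLittleO (g := fun t => ‖t - s‖ ^ 2) ?_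
    (Asymptotics.isLittleO_pow_sub_sub s one_lt_two)
  refine Asymptotics.IsBigO.of_bound 1 (Eventually.of_forall fun t => ?_)
  rw [Real.norm_eq_abs, Real.norm_eq_abs, Real.norm_eq_abs, sq_abs,
    abs_of_nonneg (sq_nonneg (t - s)), abs_le, smul_eq_mul]
  rcases max_cases t 0 with ⟨h, h'⟩ | ⟨h, h'⟩ <;> rcases max_cases s 0 with ⟨k, k'⟩ | ⟨k, k'⟩ <;>
    rw [h, k] <;> constructor <;> nlinarith

theorem hasFDerivAt_paraboloid_sq {n : ℕ} (y : EuclideanSpace ℝ (Fin n)) :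
    HasFDerivAt (fun z => paraboloid z ^ 2 / 4) (-paraboloid y • innerSL ℝ y) y := by
  have h := ((hasDerivAt_max_zero_sq (1 - ‖y‖ ^ 2)).div_const 4).comp_hasFDerivAt y
    ((hasStrictFDerivAt_norm_sq y).hasFDerivAt.const_sub 1)
  refine h.congr_fderiv ?_
  ext z
  simp [paraboloid]
  ring

/-- Integration by parts turning the radial derivative of a weighted average into an average of the
Laplacian. -/
theorem integral_paraboloid_mul_fderiv {n : ℕ} {f : EuclideanSpace ℝ (Fin n) → ℝ}
    (hf : ContDiff ℝ 2 f) (x : EuclideanSpace ℝ (Fin n)) (r : ℝ) :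
    ∫ y, paraboloid y * fderiv ℝ f (x + r • y) y =
      r * ∫ y, paraboloid y ^ 2 / 4 * lap f (x + r • y) := by
  have hf1 : ContDiff ℝ 1 (fderiv ℝ f) := hf.fderiv_right (by norm_num)
  let e (i : Fin n) : EuclideanSpace ℝ (Fin n) := EuclideanSpace.single i 1
  let g (i : Fin n) (z : EuclideanSpace ℝ (Fin n)) : ℝ := fderiv ℝ f z (e i)
  have hg : ∀ i, ContDiff ℝ 1 (g i) := fun i => hf1.clm_apply contDiff_const
  have hgc : ∀ i, Continuous fun y => g i (x + r • y) := fun i =>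
    (hg i).continuous.comp (by fun_prop)
  have hg'c : ∀ i, Continuous fun y => fderiv ℝ (g i) (x + r • y) (e i) := fun i =>
    (((hg i).continuous_fderiv one_ne_zero).comp (by fun_prop :
      Continuous fun y => x + r • y)).clm_apply continuous_const
  have hgd : ∀ i y, HasFDerivAt (fun y => g i (x + r • y)) (r • fderiv ℝ (g i) (x + r • y)) y := by
    intro i y
    have h := ((hg i).differentiable one_ne_zero (x + r • y)).hasFDerivAt.comp y
      (((hasFDerivAt_id y).const_smul r).const_add x)
    refine h.congr_fderiv ?_
    ext z
    simp
  have hip : ∀ i, ∫ y, paraboloid y ^ 2 / 4 * (r * fderiv ℝ (g i) (x + r • y) (e i)) =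
      ∫ y, paraboloid y * (y i * g i (x + r • y)) := by
    intro i
    have h := integral_mul_fderiv_eq_neg_fderiv_mul_of_integrable
      (μ := (volume : Measure (EuclideanSpace ℝ (Fin n))))
      (f := fun y => paraboloid y ^ 2 / 4) (g := fun y => g i (x + r • y)) (v := e i)
      (by
        simp only [(hasFDerivAt_paraboloid_sq _).fderiv]
        have := integrable_paraboloid_mul (n := n) (f := fun y => -(y i * g i (x + r • y)))
          (by have := hgc i; fun_prop)
        convert this using 2
        simp [e, EuclideanSpace.inner_single_right]
        ring)
      (by
        simp only [(hgd i _).fderiv]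
        exact integrable_paraboloid_sq_mul ((hg'c i).const_smul r))
      (integrable_paraboloid_sq_mul (hgc i))
      (fun y _ => (hasFDerivAt_paraboloid_sq y).differentiableAt)
      (fun y _ => (hgd i y).differentiableAt)
    simp only [(hgd i _).fderiv, (hasFDerivAt_paraboloid_sq _).fderiv] at h
    rw [← integral_neg] at h
    refine h.trans (integral_congr_ae (Eventually.of_forall fun y => ?_))
    simp [e, EuclideanSpace.inner_single_right]
    ring
  have hsum : ∀ y : EuclideanSpace ℝ (Fin n), ∑ i, y i • e i = y := by
    intro y
    ext j
    simp [e, Pi.single_apply]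
  calc
    _ = ∫ y, ∑ i, paraboloid y * (y i * g i (x + r • y)) := by
      congr with y
      have h : fderiv ℝ f (x + r • y) y = fderiv ℝ f (x + r • y) (∑ i, y i • e i) := by
        rw [hsum]
      rw [h]
      simp only [map_sum, map_smul, smul_eq_mul, Finset.mul_sum, g]
    _ = ∑ i, ∫ y, paraboloid y * (y i * g i (x + r • y)) :=
      integral_finsetSum _ fun i _ => integrable_paraboloid_mul (by have := hgc i; fun_prop)
    _ = ∑ i, ∫ y, paraboloid y ^ 2 / 4 * (r * fderiv ℝ (g i) (x + r • y) (e i)) := by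
      simp only [hip]
    _ = ∫ y, ∑ i, paraboloid y ^ 2 / 4 * (r * fderiv ℝ (g i) (x + r • y) (e i)) :=
      (integral_finsetSum _ fun i _ => integrable_paraboloid_sq_mul
        ((hg'c i).const_smul r)).symm
    _ = _ := by
      rw [← integral_const_mul]
      congr with y
      simp only [lap, Finset.mul_sum]
      exact Finset.sum_congr rfl fun i _ => by ring

/-- Mean value inequality for superharmonic functions with bounded gradient. -/
theorem integral_paraboloid_mul_le {n : ℕ} {f : EuclideanSpace ℝ (Fin n) → ℝ}
    (hf : ContDiff ℝ 2 f) {M : ℝ} (hM : ∀ x, ‖fderiv ℝ f x‖ ≤ M) (hlap : ∀ x, lap f x ≤ 0)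
    (x : EuclideanSpace ℝ (Fin n)) {R : ℝ} (hR : 0 ≤ R) :
    ∫ y, paraboloid y * f (x + R • y) ≤ (∫ y : EuclideanSpace ℝ (Fin n), paraboloid y) * f x := by
  have hfd : Differentiable ℝ f := hf.differentiable two_ne_zero
  have hcf : Continuous (fderiv ℝ f) := hf.continuous_fderiv two_ne_zero
  have hcl : ∀ r : ℝ, Continuous fun y => f (x + r • y) := fun r =>
    hf.continuous.comp (by fun_prop)
  have hcl' : ∀ r : ℝ, Continuous fun y => fderiv ℝ f (x + r • y) y := fun r =>
    (hcf.comp (by fun_prop : Continuous fun y => x + r • y)).clm_apply continuous_id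
  have hd : ∀ r : ℝ, HasDerivAt (fun r => ∫ y, paraboloid y * f (x + r • y))
      (∫ y, paraboloid y * fderiv ℝ f (x + r • y) y) r := by
    intro r
    refine (hasDerivAt_integral_of_dominated_loc_of_deriv_le (s := Set.univ)
      (bound := fun y => paraboloid y * (M * ‖y‖)) univ_mem
      (Eventually.of_forall fun s => (integrable_paraboloid_mul (hcl s)).aestronglyMeasurable)
      (integrable_paraboloid_mul (hcl r))
      (F' := fun r y => paraboloid y * fderiv ℝ f (x + r • y) y)
      (integrable_paraboloid_mul (hcl' r)).aestronglyMeasurable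
      (Eventually.of_forall fun y s _ => ?_)
      (integrable_paraboloid_mul (by fun_prop))
      (Eventually.of_forall fun y s _ => ?_)).2
    · rw [norm_mul, Real.norm_of_nonneg (paraboloid_nonneg y)]
      exact mul_le_mul_of_nonneg_left ((fderiv ℝ f _).le_of_opNorm_le (hM _) y)
        (paraboloid_nonneg y)
    · have h := (hfd (x + s • y)).hasFDerivAt.comp_hasDerivAt s
        (((hasDerivAt_id s).smul_const y).const_add x)
      simpa using h.const_mul (paraboloid y)
  have hanti : AntitoneOn (fun r : ℝ => ∫ y, paraboloid y * f (x + r • y)) (Set.Ici 0) := by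
    refine antitoneOn_of_deriv_nonpos (convex_Ici 0)
      (fun r _ => (hd r).continuousAt.continuousWithinAt)
      (fun r _ => (hd r).differentiableAt.differentiableWithinAt) fun r hr => ?_
    rw [interior_Ici, Set.mem_Ioi] at hr
    rw [(hd r).deriv, integral_paraboloid_mul_fderiv hf]
    exact mul_nonpos_of_nonneg_of_nonpos hr.le <| integral_nonpos fun y =>
      mul_nonpos_of_nonneg_of_nonpos (by positivity) (hlap _)
  have h := hanti (Set.mem_Ici.2 le_rfl) (Set.mem_Ici.2 hR) hR
  simpa [integral_mul_const] using h

theorem tendsto_integral_abs_paraboloid_translate_sub {n : ℕ} :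
    Tendsto (fun h : EuclideanSpace ℝ (Fin n) => ∫ z, |paraboloid (z + h) - paraboloid z|)
      (𝓝 0) (𝓝 0) := by
  have hc : ContinuousAt
      (fun h : EuclideanSpace ℝ (Fin n) => ∫ z, |paraboloid (z + h) - paraboloid z|) 0 := by
    have hk := continuous_paraboloid (n := n)
    refine continuousAt_of_dominated (bound := (Metric.closedBall 0 2).indicator fun _ => 1)
      (Eventually.of_forall fun h => Continuous.aestronglyMeasurable (by fun_prop)) ?_ ?_
      (Eventually.of_forall fun z => by fun_prop)
    · filter_upwards [Metric.ball_mem_nhds (0 : EuclideanSpace ℝ (Fin n)) one_pos] with h hh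
      rw [mem_ball_zero_iff] at hh
      refine Eventually.of_forall fun z => ?_
      rw [Real.norm_eq_abs, abs_abs]
      by_cases hz : z ∈ Metric.closedBall (0 : EuclideanSpace ℝ (Fin n)) 2
      · rw [Set.indicator_of_mem hz, abs_le]
        constructor <;> linarith [paraboloid_nonneg z, paraboloid_le_one z,
          paraboloid_nonneg (z + h), paraboloid_le_one (z + h)]
      · rw [Set.indicator_of_notMem hz]
        rw [mem_closedBall_zero_iff, not_le] at hz
        have h1 := norm_sub_le (z + h) h
        rw [add_sub_cancel_right] at h1
        rw [paraboloid_eq_zero (by linarith), paraboloid_eq_zero (by linarith)]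
        simp
    · exact (integrableOn_const (isCompact_closedBall _ _).measure_lt_top.ne).integrable_indicator
        measurableSet_closedBall
  simpa [ContinuousAt] using hc

theorem integral_paraboloid_mul_le_add {n : ℕ} {f : EuclideanSpace ℝ (Fin n) → ℝ}
    (hf : Continuous f) {S : ℝ} (hS : ∀ x, |f x| ≤ S) (x y : EuclideanSpace ℝ (Fin n))
    {R : ℝ} (hR : R ≠ 0) :
    ∫ z, paraboloid z * f (x + R • z) ≤ (∫ z, paraboloid z * f (y + R • z)) +
      (∫ z, |paraboloid (z + R⁻¹ • (y - x)) - paraboloid z|) * S := by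
  set h := R⁻¹ • (y - x) with hh
  have hk := continuous_paraboloid (n := n)
  have hfy : Continuous fun z => f (y + R • z) := hf.comp (by fun_prop)
  have hfx : Continuous fun z => f (x + R • z) := hf.comp (by fun_prop)
  have hpt : ∀ z, x + R • (z + h) = y + R • z := by
    intro z
    rw [smul_add, hh, smul_inv_smul₀ hR]
    abel
  have hint : Integrable fun z => |paraboloid (z + h) - paraboloid z| :=
    (((hk.integrable_of_hasCompactSupport hasCompactSupport_paraboloid).comp_add_right h).sub
      (hk.integrable_of_hasCompactSupport hasCompactSupport_paraboloid)).abs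
  rw [← integral_add_right_eq_self _ h, ← integral_mul_const,
    ← integral_add (integrable_paraboloid_mul hfy) (hint.mul_const S)]
  refine integral_mono ((integrable_paraboloid_mul hfx).comp_add_right h)
    ((integrable_paraboloid_mul hfy).add (hint.mul_const S)) fun z => ?_
  simp only [hpt]
  have h1 : (paraboloid (z + h) - paraboloid z) * f (y + R • z) ≤
      |paraboloid (z + h) - paraboloid z| * S := by
    refine (le_abs_self _).trans ?_
    rw [abs_mul]
    exact mul_le_mul_of_nonneg_left (hS _) (abs_nonneg _)
  linarith

theorem norm_gradient_sq {n : ℕ} (u : EuclideanSpace ℝ (Fin n) → ℝ)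
    (x : EuclideanSpace ℝ (Fin n)) :
    ‖gradient u x‖ ^ 2 = ∑ i, fderiv ℝ u x (EuclideanSpace.single i 1) ^ 2 := by
  rw [EuclideanSpace.norm_sq_eq]
  refine Finset.sum_congr rfl fun i _ => ?_
  have h : inner ℝ (gradient u x) (EuclideanSpace.single i (1 : ℝ)) =
      fderiv ℝ u x (EuclideanSpace.single i 1) := by
    rw [gradient, InnerProductSpace.toDual_symm_apply]
  rw [← h, EuclideanSpace.inner_single_right]
  simp

theorem norm_gradient {n : ℕ} (u : EuclideanSpace ℝ (Fin n) → ℝ)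
    (x : EuclideanSpace ℝ (Fin n)) : ‖gradient u x‖ = ‖fderiv ℝ u x‖ := by
  rw [gradient, LinearIsometryEquiv.norm_map]

theorem lap_neg {n : ℕ} (f : EuclideanSpace ℝ (Fin n) → ℝ) (x : EuclideanSpace ℝ (Fin n)) :
    lap (fun y => -f y) x = -lap f x := by
  simp [lap, fderiv_fun_neg, Finset.sum_neg_distrib]

theorem hasFDerivAt_exp_const_mul {n : ℕ} {u : EuclideanSpace ℝ (Fin n) → ℝ}
    (hu : Differentiable ℝ u) (C : ℝ) (x : EuclideanSpace ℝ (Fin n)) :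
    HasFDerivAt (fun y => Real.exp (C * u y)) (Real.exp (C * u x) • C • fderiv ℝ u x) x :=
  ((hu x).hasFDerivAt.const_mul C).exp

theorem lap_exp_const_mul {n : ℕ} {u : EuclideanSpace ℝ (Fin n) → ℝ}
    (hu : ContDiff ℝ 2 u) (C : ℝ) (x : EuclideanSpace ℝ (Fin n)) :
    lap (fun y => Real.exp (C * u y)) x =
      C * Real.exp (C * u x) * (lap u x + C * ‖gradient u x‖ ^ 2) := by
  have hud := hu.differentiable two_ne_zero
  have hu1 : ContDiff ℝ 1 (fderiv ℝ u) := hu.fderiv_right (by norm_num)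
  rw [norm_gradient_sq, lap, lap, Finset.mul_sum, ← Finset.sum_add_distrib, Finset.mul_sum]
  refine Finset.sum_congr rfl fun i _ => ?_
  simp only [(hasFDerivAt_exp_const_mul hud C _).fderiv]
  have h2 := ((hu1.clm_apply (contDiff_const (c := EuclideanSpace.single i (1 : ℝ)))).differentiable
    one_ne_zero x).hasFDerivAt.const_mul C
  have h := (hasFDerivAt_exp_const_mul hud C x).mul h2
  have h' := h.fderiv
  simp only [Pi.mul_def] at h'
  simp only [smul_apply, smul_eq_mul, h', add_apply]
  ring

/-- A bounded function with bounded gradient satisfying `0 ≤ -Δu ≤ C |∇u|²` is constant. -/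
theorem eq_of_lap_nonpos_of_neg_lap_le {n : ℕ} {u : EuclideanSpace ℝ (Fin n) → ℝ}
    (hu : ContDiff ℝ 2 u) {S M C : ℝ} (hS : ∀ x, |u x| ≤ S) (hM : ∀ x, ‖gradient u x‖ ≤ M)
    (hC : 0 < C) (hlap : ∀ x, lap u x ≤ 0) (hlap' : ∀ x, -lap u x ≤ C * ‖gradient u x‖ ^ 2)
    (x y : EuclideanSpace ℝ (Fin n)) : u x = u y := by
  set A := ∫ z : EuclideanSpace ℝ (Fin n), paraboloid z
  have hApos : 0 < A := integral_paraboloid_pos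
  have hud := hu.differentiable two_ne_zero
  have hbdd : BddBelow (Set.range u) := ⟨-S, by rintro _ ⟨z, rfl⟩; exact (abs_le.1 (hS z)).1⟩
  set m := ⨅ z, u z with hm
  have hmle : ∀ z, m ≤ u z := ciInf_le hbdd
  set w : EuclideanSpace ℝ (Fin n) → ℝ := fun z => Real.exp (C * u z) with hw
  have hwC : ContDiff ℝ 2 w := (contDiff_const.mul hu).exp
  set K := C * Real.exp (C * S) with hK
  have hKpos : 0 < K := by positivity
  have hexp : ∀ z, Real.exp (C * u z) ≤ Real.exp (C * S) := fun z =>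
    Real.exp_le_exp.2 (mul_le_mul_of_nonneg_left (abs_le.1 (hS z)).2 hC.le)
  have hwgrad : ∀ z, ‖fderiv ℝ (fun z => -w z) z‖ ≤ K * M := by
    intro z
    rw [fderiv_fun_neg, norm_neg, hw, (hasFDerivAt_exp_const_mul hud C z).fderiv, norm_smul,
      norm_smul, Real.norm_of_nonneg (Real.exp_pos _).le, Real.norm_of_nonneg hC.le,
      ← norm_gradient, ← mul_assoc, hK, mul_comm C (Real.exp _)]
    have := hexp z
    have := hM z
    gcongr
  have hwlap : ∀ z, lap (fun z => -w z) z ≤ 0 := by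
    intro z
    rw [lap_neg, hw, lap_exp_const_mul hu, neg_nonpos]
    exact mul_nonneg (by positivity) (by linarith [hlap' z])
  have hwle : ∀ z, w z ≤ Real.exp (C * m) + K * (u z - m) := by
    intro z
    have h1 := Real.add_one_le_exp (C * m - C * u z)
    have h2 : w z * Real.exp (C * m - C * u z) = Real.exp (C * m) := by
      rw [hw, ← Real.exp_add]; ring_nf
    have h3 : w z * (C * (u z - m)) ≤ Real.exp (C * S) * (C * (u z - m)) :=
      mul_le_mul_of_nonneg_right (hexp z) (mul_nonneg hC.le (sub_nonneg.2 (hmle z)))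
    have h4 := mul_le_mul_of_nonneg_left h1 (Real.exp_pos (C * u z)).le
    change w z * _ ≤ w z * _ at h4
    rw [h2] at h4
    rw [hK]
    linarith
  have hcomp : ∀ a b, w a ≤ Real.exp (C * m) + K * (u b - m) := by
    intro a b
    let T (R : ℝ) : ℝ := ∫ z, |paraboloid (z + R⁻¹ • (b - a)) - paraboloid z|
    have hT : Tendsto T atTop (𝓝 0) := by
      refine tendsto_integral_abs_paraboloid_translate_sub.comp ?_
      simpa using (tendsto_inv_atTop_zero (𝕜 := ℝ)).smul_const (b - a)
    have hR : ∀ R > 0, A * w a ≤ A * (Real.exp (C * m) + K * (u b - m)) + K * (T R * S) := by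
      intro R hR
      have hcu : Continuous fun z => u (a + R • z) := hu.continuous.comp (by fun_prop)
      have hcw : Continuous fun z => w (a + R • z) := hwC.continuous.comp (by fun_prop)
      have h1 := integral_paraboloid_mul_le hwC.neg hwgrad hwlap a hR.le
      simp only [mul_neg, integral_neg, neg_le_neg_iff] at h1
      have h2 : ∫ z, paraboloid z * w (a + R • z) ≤
          ∫ z, (paraboloid z * (Real.exp (C * m) - K * m) +
            K * (paraboloid z * u (a + R • z))) := by
        refine integral_mono (integrable_paraboloid_mul hcw)
          ((integrable_paraboloid_mul continuous_const).add
            ((integrable_paraboloid_mul hcu).const_mul K)) fun z => ?_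
        have := mul_le_mul_of_nonneg_left (hwle (a + R • z)) (paraboloid_nonneg z)
        simp only
        linarith
      rw [integral_add (integrable_paraboloid_mul continuous_const)
        ((integrable_paraboloid_mul hcu).const_mul K), integral_mul_const, integral_const_mul] at h2
      have h3 := integral_paraboloid_mul_le_add hu.continuous hS a b hR.ne'
      have h4 := integral_paraboloid_mul_le hu (fun z => (norm_gradient u z).symm.trans_le (hM z))
        hlap b hR.le
      have h5 := mul_le_mul_of_nonneg_left (h3.trans (add_le_add_left h4 _)) hKpos.le
      simp only [T]
      linarith
    have hlim : Tendsto (fun R => A * (Real.exp (C * m) + K * (u b - m)) + K * (T R * S)) atTop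
        (𝓝 (A * (Real.exp (C * m) + K * (u b - m)))) := by
      simpa using ((hT.mul_const S).const_mul K).const_add
        (A * (Real.exp (C * m) + K * (u b - m)))
    exact le_of_mul_le_mul_left
      (ge_of_tendsto hlim ((eventually_gt_atTop 0).mono hR)) hApos
  have hle : ∀ a, u a ≤ m := by
    intro a
    have h : (w a - Real.exp (C * m)) / K + m ≤ m := by
      conv_rhs => rw [hm]
      refine le_ciInf fun b => ?_
      have := hcomp a b
      rw [← le_sub_iff_add_le, div_le_iff₀ hKpos]
      linarith
    have h' : (w a - Real.exp (C * m)) / K ≤ 0 := by linarith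
    rw [div_le_iff₀ hKpos, zero_mul, sub_nonpos] at h'
    exact le_of_mul_le_mul_left (Real.exp_le_exp.1 h') hC
  exact le_antisymm ((hle x).trans (hmle y)) ((hle y).trans (hmle x))

/-- Liouville property of a single equation of the system, the other unknown being a bounded
coefficient. -/
theorem eq_of_neg_lap_eq {n : ℕ} {p q r : ℝ} (hp : 2 ≤ p) (hq : 0 ≤ q) (hr : 0 ≤ r)
    {u v : EuclideanSpace ℝ (Fin n) → ℝ} (hu_nonneg : ∀ x, 0 ≤ u x) (hv_nonneg : ∀ x, 0 ≤ v x)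
    (hu_bdd : ∃ M : ℝ, ∀ x, u x ≤ M) (hv_bdd : ∃ M : ℝ, ∀ x, v x ≤ M)
    (hgu_bdd : ∃ M : ℝ, ∀ x, ‖gradient u x‖ ≤ M) (hu : ContDiff ℝ 2 u)
    (heq : ∀ x, -lap u x = u x ^ q * v x ^ r * ‖gradient u x‖ ^ p)
    (x y : EuclideanSpace ℝ (Fin n)) : u x = u y := by
  obtain ⟨a, ha⟩ := hu_bdd
  obtain ⟨b, hb⟩ := hv_bdd
  obtain ⟨M, hM⟩ := hgu_bdd
  have ha0 : 0 ≤ a := (hu_nonneg 0).trans (ha 0)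
  have hb0 : 0 ≤ b := (hv_nonneg 0).trans (hb 0)
  have hM0 : 0 ≤ M := (norm_nonneg _).trans (hM 0)
  refine eq_of_lap_nonpos_of_neg_lap_le hu (S := a) (M := M)
    (C := a ^ q * b ^ r * M ^ (p - 2) + 1) (fun z => by rw [abs_of_nonneg (hu_nonneg z)]; exact ha z)
    hM (by positivity) (fun z => ?_) (fun z => ?_) x y
  · have := hu_nonneg z
    have := hv_nonneg z
    have h : 0 ≤ -lap u z := by rw [heq]; positivity
    linarith
  · have h1 : ‖gradient u z‖ ^ p = ‖gradient u z‖ ^ (p - 2) * ‖gradient u z‖ ^ 2 := by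
      rw [← Real.rpow_two, ← Real.rpow_add_of_nonneg (norm_nonneg _) (by linarith) zero_le_two,
        sub_add_cancel]
    rw [heq, h1, ← mul_assoc]
    refine mul_le_mul_of_nonneg_right ?_ (by positivity)
    have h2 := Real.rpow_le_rpow (hu_nonneg z) (ha z) hq
    have h3 := Real.rpow_le_rpow (hv_nonneg z) (hb z) hr
    have h4 := Real.rpow_le_rpow (norm_nonneg _) (hM z) (by linarith : 0 ≤ p - 2)
    have h5 := Real.rpow_nonneg (hv_nonneg z) r
    have h6 : u z ^ q * v z ^ r * ‖gradient u z‖ ^ (p - 2) ≤ a ^ q * b ^ r * M ^ (p - 2) := by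
      gcongr
    linarith

/-- **Liouville theorem for the model system with `p₁, p₂ ≥ 2`** (Remark 1.2(a)):
any pair of nonnegative classical solutions of
`-Δu = u^{q₁} v^{r₁} |∇u|^{p₁}`, `-Δv = v^{q₂} u^{r₂} |∇v|^{p₂}` in `ℝⁿ` with
`u, v, |∇u|, |∇v|` bounded is constant. -/
theorem liouville_model_system_superquadratic {n : ℕ} (hn : 1 ≤ n)
    {p₁ p₂ q₁ q₂ r₁ r₂ : ℝ} (hp₁ : 2 ≤ p₁) (hp₂ : 2 ≤ p₂)
    (hq₁ : 0 ≤ q₁) (hq₂ : 0 ≤ q₂) (hr₁ : 0 ≤ r₁) (hr₂ : 0 ≤ r₂)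
    (u v : EuclideanSpace ℝ (Fin n) → ℝ)
    (hu_nonneg : ∀ x, 0 ≤ u x) (hv_nonneg : ∀ x, 0 ≤ v x)
    (hu_bdd : ∃ M : ℝ, ∀ x, u x ≤ M) (hv_bdd : ∃ M : ℝ, ∀ x, v x ≤ M)
    (hgu_bdd : ∃ M : ℝ, ∀ x, ‖gradient u x‖ ≤ M)
    (hgv_bdd : ∃ M : ℝ, ∀ x, ‖gradient v x‖ ≤ M)
    (hu_C2 : ContDiff ℝ 2 u) (hv_C2 : ContDiff ℝ 2 v)
    (hequ : ∀ x, -lap u x = u x ^ q₁ * v x ^ r₁ * ‖gradient u x‖ ^ p₁)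
    (heqv : ∀ x, -lap v x = v x ^ q₂ * u x ^ r₂ * ‖gradient v x‖ ^ p₂) :
    (∀ x y, u x = u y) ∧ (∀ x y, v x = v y) := by
  exact ⟨eq_of_neg_lap_eq hp₁ hq₁ hr₁ hu_nonneg hv_nonneg hu_bdd hv_bdd hgu_bdd hu_C2 hequ,
    eq_of_neg_lap_eq hp₂ hq₂ hr₂ hv_nonneg hu_nonneg hv_bdd hu_bdd hgv_bdd hv_C2 heqv⟩
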